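/- arXiv:2408.17158 — 2 statements merged into one kernel-verified Lean document; each statement's English description precedes it below -/
import Mathlib

section
/- Let ρ : ℝ³ → [0,∞) be measurable with ρ ∈ L¹(ℝ³) ∩ L^{3/2}(ℝ³). Then for every r ∈ (3,∞), the function x ↦ ∫_{ℝ³} ρ(y)/|x−y| dy belongs to L^r(ℝ³). -/
noncomputable section
open MeasureTheory

/-- Position space `ℝ³`. -/
abbrev Space : Type := EuclideanSpace ℝ (Fin 3)

open scoped ENNReal

/-- **Young's convolution inequality** for `ℝ≥0∞`-valued functions, raised to the power `r`. -/
theorem lintegral_rpow_lintegral_sub_mul_le {G : Type*} [AddGroup G] [MeasurableSpace G]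
    [MeasurableAdd₂ G] [MeasurableNeg G] {μ : Measure G} [SFinite μ] [μ.IsAddLeftInvariant]
    [μ.IsAddRightInvariant] [μ.IsNegInvariant] {k f : G → ℝ≥0∞} (hk : Measurable k)
    (hf : Measurable f) {p s r : ℝ} (hp : 0 < p) (hs : 0 < s) (hpr : p ≤ r) (hsr : s ≤ r)
    (hpsr : p⁻¹ + s⁻¹ = 1 + r⁻¹) :
    ∫⁻ x, (∫⁻ y, k (x - y) * f y ∂μ) ^ r ∂μ ≤
      (∫⁻ x, k x ^ p ∂μ) * (∫⁻ x, f x ^ s ∂μ) *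
        ((∫⁻ x, k x ^ p ∂μ) ^ (p⁻¹ - r⁻¹) * (∫⁻ x, f x ^ s ∂μ) ^ (s⁻¹ - r⁻¹)) ^ r := by
  have hr : 0 < r := hp.trans_le hpr
  have ha : 0 ≤ p⁻¹ - r⁻¹ := sub_nonneg.2 (inv_anti₀ hp hpr)
  have hb : 0 ≤ s⁻¹ - r⁻¹ := sub_nonneg.2 (inv_anti₀ hs hsr)
  have split (t : ℝ≥0∞) {q : ℝ} (hq : 0 < q) (h : 0 ≤ q⁻¹ - r⁻¹) :
      (t ^ q) ^ r⁻¹ * (t ^ q) ^ (q⁻¹ - r⁻¹) = t := by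
    rw [← ENNReal.rpow_add_of_nonneg _ _ (inv_nonneg.2 hr.le) h, add_sub_cancel,
      ENNReal.rpow_rpow_inv hq.ne']
  have hkp (x : G) : ∫⁻ y, k (x - y) ^ p ∂μ = ∫⁻ y, k y ^ p ∂μ :=
    lintegral_sub_left_eq_self (μ := μ) (fun y ↦ k y ^ p) x
  have holder (x : G) : ∫⁻ y, k (x - y) * f y ∂μ ≤
      (∫⁻ y, k (x - y) ^ p * f y ^ s ∂μ) ^ r⁻¹ *
        ((∫⁻ y, k y ^ p ∂μ) ^ (p⁻¹ - r⁻¹) * (∫⁻ y, f y ^ s ∂μ) ^ (s⁻¹ - r⁻¹)) := by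
    have key := ENNReal.lintegral_mul_prod_norm_pow_le (μ := μ) Finset.univ
      (g := fun y ↦ k (x - y) ^ p * f y ^ s)
      (f := ![fun y ↦ k (x - y) ^ p, fun y ↦ f y ^ s]) (by fun_prop)
      (by simp only [Finset.mem_univ, forall_const, Fin.forall_fin_two]
          constructor <;> simp <;> fun_prop)
      r⁻¹ (p := ![p⁻¹ - r⁻¹, s⁻¹ - r⁻¹]) (by simp [Fin.sum_univ_two]; linarith)
      (inv_nonneg.2 hr.le) (by simp only [Finset.mem_univ, forall_const, Fin.forall_fin_two]
                               exact ⟨ha, hb⟩)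
    simp only [Fin.prod_univ_two, Matrix.cons_val_zero, Matrix.cons_val_one, hkp] at key
    refine le_trans (le_of_eq (lintegral_congr fun y ↦ ?_)) key
    rw [ENNReal.mul_rpow_of_nonneg _ _ (inv_nonneg.2 hr.le), mul_mul_mul_comm, split _ hp ha,
      split _ hs hb]
  calc
    ∫⁻ x, (∫⁻ y, k (x - y) * f y ∂μ) ^ r ∂μ
      ≤ ∫⁻ x, (∫⁻ y, k (x - y) ^ p * f y ^ s ∂μ) *
          ((∫⁻ y, k y ^ p ∂μ) ^ (p⁻¹ - r⁻¹) * (∫⁻ y, f y ^ s ∂μ) ^ (s⁻¹ - r⁻¹)) ^ r ∂μ := by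
        refine lintegral_mono fun x ↦ (ENNReal.rpow_le_rpow (holder x) hr.le).trans_eq ?_
        rw [ENNReal.mul_rpow_of_nonneg _ _ hr.le, ENNReal.rpow_inv_rpow hr.ne']
    _ = _ := by
        have hprod : Measurable (Function.uncurry fun x y ↦ k (x - y) ^ p * f y ^ s) := by
          unfold Function.uncurry
          fun_prop
        have hm : Measurable fun x ↦ ∫⁻ y, k (x - y) ^ p * f y ^ s ∂μ :=
          hprod.lintegral_prod_right'
        rw [lintegral_mul_const _ hm, lintegral_lintegral_swap hprod.aemeasurable]
        congr 1
        rw [← lintegral_const_mul _ (by fun_prop)]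
        refine lintegral_congr fun y ↦ ?_
        rw [lintegral_mul_const _ (by fun_prop),
          lintegral_sub_right_eq_self (μ := μ) (fun x ↦ k x ^ p) y]

/-- Finiteness form of **Young's convolution inequality**. -/
theorem lintegral_rpow_lintegral_sub_mul_lt_top {G : Type*} [AddGroup G] [MeasurableSpace G]
    [MeasurableAdd₂ G] [MeasurableNeg G] {μ : Measure G} [SFinite μ] [μ.IsAddLeftInvariant]
    [μ.IsAddRightInvariant] [μ.IsNegInvariant] {k f : G → ℝ≥0∞} (hk : Measurable k)
    (hf : Measurable f) {p s r : ℝ} (hp : 0 < p) (hs : 0 < s) (hpr : p ≤ r) (hsr : s ≤ r)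
    (hpsr : p⁻¹ + s⁻¹ = 1 + r⁻¹) (hkp : ∫⁻ x, k x ^ p ∂μ < ∞) (hfs : ∫⁻ x, f x ^ s ∂μ < ∞) :
    ∫⁻ x, (∫⁻ y, k (x - y) * f y ∂μ) ^ r ∂μ < ∞ := by
  refine (lintegral_rpow_lintegral_sub_mul_le hk hf hp hs hpr hsr hpsr).trans_lt ?_
  have ha : 0 ≤ p⁻¹ - r⁻¹ := sub_nonneg.2 (inv_anti₀ hp hpr)
  have hb : 0 ≤ s⁻¹ - r⁻¹ := sub_nonneg.2 (inv_anti₀ hs hsr)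
  exact ENNReal.mul_lt_top (ENNReal.mul_lt_top hkp hfs)
    (ENNReal.rpow_lt_top_of_nonneg (hp.trans_le hpr).le (ENNReal.mul_lt_top
      (ENNReal.rpow_lt_top_of_nonneg ha hkp.ne) (ENNReal.rpow_lt_top_of_nonneg hb hfs.ne)).ne)

theorem enorm_norm_inv_rpow {E : Type*} [SeminormedAddGroup E] (x : E) {p : ℝ} (hp : 0 ≤ p) :
    ‖‖x‖⁻¹‖ₑ ^ p = ‖‖x‖ ^ (-p)‖ₑ := by
  rw [← Real.enorm_rpow_of_nonneg (by positivity) hp, Real.inv_rpow (norm_nonneg x),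
    Real.rpow_neg (norm_nonneg x)]

section NormInv

variable {E : Type*} [NormedAddCommGroup E] [NormedSpace ℝ E] [FiniteDimensional ℝ E]
  [MeasurableSpace E] [BorelSpace E] (μ : Measure E) [μ.IsAddHaarMeasure]

theorem setLIntegral_ball_enorm_norm_inv_rpow_lt_top {p : ℝ} (hp : 0 ≤ p)
    (hd : 1 ≤ Module.finrank ℝ E) (hpd : p < Module.finrank ℝ E) :
    ∫⁻ x in Metric.ball (0 : E) 1, ‖‖x‖⁻¹‖ₑ ^ p ∂μ < ∞ := by
  have h : IntegrableOn (fun x : E ↦ ‖x‖ ^ (-p)) (Metric.ball 0 1) μ :=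
    integrableOn_ball_of_norm_le_rpow (C := 1) hd hpd
      (ae_of_all _ fun x ↦ by
        rw [one_mul, Real.norm_of_nonneg (Real.rpow_nonneg (norm_nonneg x) _)])
      (measurable_norm.pow_const (-p)).aestronglyMeasurable
  simp only [enorm_norm_inv_rpow _ hp]
  exact h.2

theorem setLIntegral_compl_ball_enorm_norm_inv_rpow_lt_top {p : ℝ}
    (hpd : (Module.finrank ℝ E : ℝ) < p) :
    ∫⁻ x in (Metric.ball (0 : E) 1)ᶜ, ‖‖x‖⁻¹‖ₑ ^ p ∂μ < ∞ := by
  have hp : 0 < p := (Nat.cast_nonneg _).trans_lt hpd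
  have h : IntegrableOn (fun x : E ↦ ‖x‖ ^ (-p)) (Metric.ball 0 1)ᶜ μ := by
    refine Integrable.mono' ((integrable_one_add_norm (μ := μ) hpd).const_mul (2 ^ p)).integrableOn
      (measurable_norm.pow_const (-p)).aestronglyMeasurable ?_
    refine (ae_restrict_iff' Metric.isOpen_ball.measurableSet.compl).2 (ae_of_all _ fun x hx ↦ ?_)
    have hx : 1 ≤ ‖x‖ := by simpa using hx
    rw [Real.norm_of_nonneg (by positivity), Real.rpow_neg (by positivity),
      Real.rpow_neg (by positivity), ← div_eq_mul_inv,
      ← Real.div_rpow (by positivity) (by positivity), ← Real.inv_rpow (by positivity)]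
    refine Real.rpow_le_rpow (by positivity) ?_ hp.le
    rw [inv_eq_one_div, div_le_div_iff₀ (by positivity) (by positivity)]
    linarith
  simp only [enorm_norm_inv_rpow _ hp.le]
  exact h.2

end NormInv

theorem lintegral_indicator_rpow {α : Type*} [MeasurableSpace α] {μ : Measure α} {S : Set α}
    (hS : MeasurableSet S) (f : α → ℝ≥0∞) {p : ℝ} (hp : 0 < p) :
    ∫⁻ x, S.indicator f x ^ p ∂μ = ∫⁻ x in S, f x ^ p ∂μ := by
  rw [← lintegral_indicator hS]
  refine lintegral_congr fun x ↦ ?_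
  by_cases hx : x ∈ S <;> simp [hx, hp]

/-- Let `ρ : ℝ³ → [0,∞)` be measurable with `ρ ∈ L¹ ∩ L^{3/2}`. Then
for every `r ∈ (3,∞)`, the Coulomb potential `x ↦ ∫ ρ(y)/|x−y| dy` belongs to `L^r(ℝ³)`. -/
theorem coulomb_potential_Lr (ρ : Space → ℝ) (hmeas : Measurable ρ)
    (hnonneg : ∀ x, 0 ≤ ρ x)
    (hL1 : MemLp ρ 1 volume) (hL32 : MemLp ρ (ENNReal.ofReal (3 / 2)) volume)
    (r : ℝ) (hr : 3 < r) :
    MemLp (fun x : Space => ∫ y : Space, ρ y / ‖x - y‖) (ENNReal.ofReal r) volume := by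
  have hr0 : 0 < r := by linarith
  have hdim : Module.finrank ℝ Space = 3 := by simp
  have hL1' : ∫⁻ x, ‖ρ x‖ₑ ^ (1 : ℝ) < ∞ := by
    simpa using lintegral_rpow_enorm_lt_top_of_eLpNorm_lt_top one_ne_zero ENNReal.one_ne_top hL1.2
  have hL32' : ∫⁻ x, ‖ρ x‖ₑ ^ (3 / 2 : ℝ) < ∞ := by
    have h := lintegral_rpow_enorm_lt_top_of_eLpNorm_lt_top (by simp) ENNReal.ofReal_ne_top hL32.2
    rwa [ENNReal.toReal_ofReal (by norm_num)] at h
  set B : Set Space := Metric.ball 0 1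
  have hB : MeasurableSet B := Metric.isOpen_ball.measurableSet
  let k : Space → ℝ≥0∞ := fun z ↦ ‖‖z‖⁻¹‖ₑ
  have hk : Measurable k := by fun_prop
  have hρ : Measurable fun y ↦ ‖ρ y‖ₑ := hmeas.enorm
  have near : ∫⁻ x : Space, (∫⁻ y, B.indicator k (x - y) * ‖ρ y‖ₑ) ^ r < ∞ := by
    have hp : 0 < 3 * r / (r + 3) := by positivity
    refine lintegral_rpow_lintegral_sub_mul_lt_top (p := 3 * r / (r + 3)) (s := 3 / 2)
      (hk.indicator hB) hρ hp (by norm_num) ?_ (by linarith) (by field_simp; ring) ?_ hL32'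
    · rw [div_le_iff₀ (by positivity)]
      nlinarith
    · rw [lintegral_indicator_rpow hB _ hp]
      refine setLIntegral_ball_enorm_norm_inv_rpow_lt_top volume hp.le (by simp) ?_
      rw [hdim, div_lt_iff₀ (by positivity)]
      push_cast
      linarith
  have far : ∫⁻ x : Space, (∫⁻ y, Bᶜ.indicator k (x - y) * ‖ρ y‖ₑ) ^ r < ∞ := by
    refine lintegral_rpow_lintegral_sub_mul_lt_top (p := r) (s := 1)
      (hk.indicator hB.compl) hρ hr0 one_pos le_rfl (by linarith) (by ring) ?_ hL1'
    rw [lintegral_indicator_rpow hB.compl _ hr0]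
    exact setLIntegral_compl_ball_enorm_norm_inv_rpow_lt_top volume (by rw [hdim]; exact_mod_cast hr)
  refine ⟨(StronglyMeasurable.integral_prod_right' (ν := volume)
    (f := fun z : Space × Space ↦ ρ z.2 / ‖z.1 - z.2‖)
    (Measurable.stronglyMeasurable (by fun_prop))).aestronglyMeasurable, ?_⟩
  rw [eLpNorm_lt_top_iff_lintegral_rpow_enorm_lt_top (by simpa using hr0) ENNReal.ofReal_ne_top,
    ENNReal.toReal_ofReal hr0.le]
  have bound (x : Space) : ‖∫ y : Space, ρ y / ‖x - y‖‖ₑ ≤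
      (∫⁻ y, B.indicator k (x - y) * ‖ρ y‖ₑ) + ∫⁻ y, Bᶜ.indicator k (x - y) * ‖ρ y‖ₑ := by
    have hm : Measurable fun y ↦ B.indicator k (x - y) * ‖ρ y‖ₑ :=
      ((hk.indicator hB).comp (measurable_const.sub measurable_id)).mul hρ
    rw [← lintegral_add_left hm]
    refine (enorm_integral_le_lintegral_enorm _).trans_eq (lintegral_congr fun y ↦ ?_)
    rw [← add_mul, ← Pi.add_apply, Set.indicator_self_add_compl, div_eq_inv_mul, enorm_mul]
  calc
    ∫⁻ x : Space, ‖∫ y : Space, ρ y / ‖x - y‖‖ₑ ^ r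
      ≤ ∫⁻ x : Space, 2 ^ (r - 1) * ((∫⁻ y, B.indicator k (x - y) * ‖ρ y‖ₑ) ^ r +
          (∫⁻ y, Bᶜ.indicator k (x - y) * ‖ρ y‖ₑ) ^ r) :=
        lintegral_mono fun x ↦ (ENNReal.rpow_le_rpow (bound x) hr0.le).trans
          (ENNReal.rpow_add_le_mul_rpow_add_rpow _ _ (by linarith))
    _ < ∞ := by
        have hm : Measurable fun x : Space ↦ ∫⁻ y, B.indicator k (x - y) * ‖ρ y‖ₑ :=
          Measurable.lintegral_prod_right'
            (f := fun z : Space × Space ↦ B.indicator k (z.1 - z.2) * ‖ρ z.2‖ₑ)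
            (((hk.indicator hB).comp (measurable_fst.sub measurable_snd)).mul
              (hρ.comp measurable_snd))
        rw [lintegral_const_mul' _ _
            (ENNReal.rpow_ne_top_of_nonneg (by linarith) ENNReal.ofNat_ne_top),
          lintegral_add_left (hm.pow_const r)]
        exact ENNReal.mul_lt_top (ENNReal.rpow_lt_top_of_nonneg (by linarith) ENNReal.ofNat_ne_top)
          (ENNReal.add_lt_top.2 ⟨near, far⟩)
end
end

section
/- For every κ ∈ (0,1) and all A, B > 0 there exists a constant C > 0 such that: for every Z ≥ 1, setting c := Z/κ, for every N ∈ ℕ with N ≤ A·Z and every orthonormal family ξ_1, …, ξ_N of Schwartz functions in L²(ℝ³;ℂ⁴) (orbital data with λ_1 = ⋯ = λ_N = 1 and λ_n = 0 for n > N, i.e. γ a rank-N orthogonal projection) satisfying tr(T_cγ) ≤ B·Z^{7/3}, the exchange energy satisfies 𝒳[γ] ≤ C·Z^{5/3}. -/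
noncomputable section
open MeasureTheory SchwartzMap Real

/-- Spinor space `ℂ⁴`, with the Euclidean (ℓ²) norm, so that
`‖v‖² = ∑_{σ=1}^4 |v_σ|²`. -/
abbrev Spinor : Type := EuclideanSpace ℂ (Fin 4)

/-- Orbital data: an orthonormal family `(ξ_n)` of Schwartz functions in `L²(ℝ³; ℂ⁴)`
together with nonnegative occupation numbers `(λ_n)` with `∑ λ_n < ∞`. -/
structure OrbitalData where
  xi : ℕ → SchwartzMap Space Spinor
  lam : ℕ → ℝ
  lam_nonneg : ∀ n, 0 ≤ lam n
  lam_summable : Summable lam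
  orthonormal : ∀ m n : ℕ,
    ∫ x : Space, (inner ℂ (xi m x) (xi n x) : ℂ) = if m = n then 1 else 0

/-- The density `ρ_γ(x) = ∑_n λ_n ∑_{σ=1}^4 |ξ_n(x,σ)|²`. -/
def OrbitalData.density (Γ : OrbitalData) (x : Space) : ℝ :=
  ∑' n, Γ.lam n * ‖Γ.xi n x‖ ^ 2

/-- The density-matrix kernel `γ(x,σ;y,τ) = ∑_n λ_n ξ_n(x,σ) conj(ξ_n(y,τ))`. -/
def OrbitalData.kernel (Γ : OrbitalData) (x y : Space) (σ τ : Fin 4) : ℂ :=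
  ∑' n, Γ.lam n * Γ.xi n x σ * (starRingEnd ℂ) (Γ.xi n y τ)

/-- The square-root kernel `γ^{1/2}(x,σ;y,τ) = ∑_n √λ_n ξ_n(x,σ) conj(ξ_n(y,τ))`. -/
def OrbitalData.sqrtKernel (Γ : OrbitalData) (x y : Space) (σ τ : Fin 4) : ℂ :=
  ∑' n, Real.sqrt (Γ.lam n) * Γ.xi n x σ * (starRingEnd ℂ) (Γ.xi n y τ)

/-- The (componentwise) Fourier transform `ξ̂_n` of the orbital `ξ_n`. -/
def OrbitalData.fourier (Γ : OrbitalData) (n : ℕ) : SchwartzMap Space Spinor :=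
  fourierTransformCLM ℂ (Γ.xi n)

/-- `tr(|p|γ) = ∑_n λ_n ∫ |p| ‖ξ̂_n(p)‖² dp`. -/
def OrbitalData.trMomentum (Γ : OrbitalData) : ℝ :=
  ∑' n, Γ.lam n * ∫ p : Space, ‖p‖ * ‖Γ.fourier n p‖ ^ 2

/-- `tr(T_c γ) = ∑_n λ_n ∫ (√(c²|p|²+c⁴) − c²) ‖ξ̂_n(p)‖² dp`. -/
def OrbitalData.trKinetic (c : ℝ) (Γ : OrbitalData) : ℝ :=
  ∑' n, Γ.lam n *
    ∫ p : Space, (Real.sqrt (c ^ 2 * ‖p‖ ^ 2 + c ^ 4) - c ^ 2) * ‖Γ.fourier n p‖ ^ 2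

/-- The mean-field (Coulomb) potential `φ_γ(x) = ∫ ρ_γ(y)/|x−y| dy`. -/
def OrbitalData.meanField (Γ : OrbitalData) (x : Space) : ℝ :=
  ∫ y : Space, Γ.density y / ‖x - y‖

/-- The exchange energy `𝒳[γ] = ½ ∫∫ ∑_{σ,τ} |γ(x,σ;y,τ)|²/|x−y| dx dy`. -/
def OrbitalData.exchange (Γ : OrbitalData) : ℝ :=
  (1 / 2) * ∫ x : Space, ∫ y : Space,
    (∑ σ : Fin 4, ∑ τ : Fin 4, ‖Γ.kernel x y σ τ‖ ^ 2) / ‖x - y‖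

/-- The Müller exchange energy `𝒳[γ^{1/2}]`. -/
def OrbitalData.exchangeSqrt (Γ : OrbitalData) : ℝ :=
  (1 / 2) * ∫ x : Space, ∫ y : Space,
    (∑ σ : Fin 4, ∑ τ : Fin 4, ‖Γ.sqrtKernel x y σ τ‖ ^ 2) / ‖x - y‖

/-- The Coulomb energy `D[ρ] = ½ ∫∫ ρ(x)ρ(y)/|x−y| dx dy`. -/
def coulombD (ρ : Space → ℝ) : ℝ :=
  (1 / 2) * ∫ x : Space, ∫ y : Space, ρ x * ρ y / ‖x - y‖

open Complex in
/-- The three Dirac `α` matrices in standard representation. -/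
def diracAlpha : Fin 3 → Matrix (Fin 4) (Fin 4) ℂ
  | 0 => !![0, 0, 0, 1; 0, 0, 1, 0; 0, 1, 0, 0; 1, 0, 0, 0]
  | 1 => !![0, 0, 0, -I; 0, 0, I, 0; 0, -I, 0, 0; I, 0, 0, 0]
  | 2 => !![0, 0, 1, 0; 0, 0, 0, -1; 1, 0, 0, 0; 0, -1, 0, 0]

/-- The Dirac `β` matrix in standard representation. -/
def diracBeta : Matrix (Fin 4) (Fin 4) ℂ :=
  !![1, 0, 0, 0; 0, 1, 0, 0; 0, 0, -1, 0; 0, 0, 0, -1]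

/-- The positive-energy Dirac projection
`Λ₊(p) = ½ (1 + (c α·p + βc²)/√(c²|p|²+c⁴))`. -/
def posProj (c : ℝ) (p : Space) : Matrix (Fin 4) (Fin 4) ℂ :=
  (1 / 2 : ℂ) • (1 + ((Real.sqrt (c ^ 2 * ‖p‖ ^ 2 + c ^ 4) : ℂ))⁻¹ •
    ((c : ℂ) • (∑ j : Fin 3, (p j : ℂ) • diracAlpha j) + ((c : ℂ) ^ 2) • diracBeta))

/-- The orbital data belongs to the free picture (for velocity of light `c`) if each
`ξ̂_n(p)` lies in the range of the positive-energy projection `Λ₊(p)` for a.e. `p`. -/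
def OrbitalData.FreePicture (c : ℝ) (Γ : OrbitalData) : Prop :=
  ∀ n : ℕ, ∀ᵐ p : Space, ∀ σ : Fin 4,
    Γ.fourier n p σ = ∑ τ : Fin 4, posProj c p σ τ * Γ.fourier n p τ
open scoped ENNReal FourierTransform

section FractionalHardy

lemma enorm_add_sq_le {E : Type*} [SeminormedAddCommGroup E] (a b : E) :
    ‖a + b‖ₑ ^ 2 ≤ 2 * ‖a‖ₑ ^ 2 + 2 * ‖b‖ₑ ^ 2 := by
  have h : ‖a + b‖ ^ 2 ≤ 2 * ‖a‖ ^ 2 + 2 * ‖b‖ ^ 2 := by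
    nlinarith [norm_add_le a b, norm_nonneg (a + b), sq_nonneg (‖a‖ - ‖b‖)]
  simp only [← ofReal_norm]
  rw [← ENNReal.ofReal_pow (norm_nonneg _), ← ENNReal.ofReal_pow (norm_nonneg _),
    ← ENNReal.ofReal_pow (norm_nonneg _), ← ENNReal.ofReal_ofNat 2,
    ← ENNReal.ofReal_mul (by norm_num), ← ENNReal.ofReal_mul (by norm_num),
    ← ENNReal.ofReal_add (by positivity) (by positivity)]
  exact ENNReal.ofReal_le_ofReal h

variable {H : Type*} [NormedAddCommGroup H] [InnerProductSpace ℂ H]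

/-- The integral of `‖p‖⁻²` over a ball of `ℝ³` is a multiple of its radius. -/
lemma lintegral_ball_inv_norm_sq (S : ℝ) (hS : 0 ≤ S) :
    ∫⁻ p in Metric.ball (0 : Space) S, ENNReal.ofReal ((‖p‖ ^ 2)⁻¹)
      = 3 * volume (Metric.ball (0 : Space) 1) * ENNReal.ofReal S := by
  have key : ∀ y ∈ Set.Ioi (0 : ℝ), y ^ (Module.finrank ℝ Space - 1) •
      (Set.Iio S).indicator (fun r : ℝ => (r ^ 2)⁻¹) y
      = (Set.Iio S).indicator (fun _ => (1 : ℝ)) y := by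
    intro y (hy : 0 < y)
    by_cases h : y < S <;> simp [h, hy.ne']
  have hint : Integrable (fun p : Space =>
      (Set.Iio S).indicator (fun r : ℝ => (r ^ 2)⁻¹) ‖p‖) := by
    rw [integrable_fun_norm_addHaar volume (f := (Set.Iio S).indicator (fun r : ℝ => (r ^ 2)⁻¹)),
      integrableOn_congr_fun key measurableSet_Ioi, integrableOn_indicator_iff measurableSet_Iio,
      Set.Iio_inter_Ioi]
    exact integrableOn_const (by simp)
  have hnn : 0 ≤ᵐ[volume] fun p : Space =>
      (Set.Iio S).indicator (fun r : ℝ => (r ^ 2)⁻¹) ‖p‖ :=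
    .of_forall fun p => Set.indicator_nonneg (fun r _ => by positivity) _
  have h1 := ofReal_integral_eq_lintegral_ofReal hint hnn
  rw [integral_fun_norm_addHaar volume, setIntegral_congr_fun measurableSet_Ioi key,
    setIntegral_indicator measurableSet_Iio, Set.Ioi_inter_Iio] at h1
  rw [← lintegral_indicator measurableSet_ball]
  have h2 : ∀ p : Space, (Metric.ball (0 : Space) S).indicator
      (fun p => ENNReal.ofReal ((‖p‖ ^ 2)⁻¹)) p
      = ENNReal.ofReal ((Set.Iio S).indicator (fun r : ℝ => (r ^ 2)⁻¹) ‖p‖) := by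
    intro p
    by_cases h : ‖p‖ < S <;> simp [h]
  simp_rw [h2]
  rw [← h1]
  have hr : volume.real (Set.Ioo 0 S) = S := by simp [Measure.real, hS]
  simp only [integral_const, smul_eq_mul, mul_one, nsmul_eq_mul, measureReal_restrict_apply_univ,
    hr, finrank_euclideanSpace, Fintype.card_fin]
  rw [ENNReal.ofReal_mul (by positivity), ENNReal.ofReal_mul (by positivity), Measure.real,
    ENNReal.ofReal_toReal measure_ball_lt_top.ne]
  simp [mul_assoc]

lemma lintegral_enorm_sq_fourierInv [CompleteSpace H] (f : 𝓢(Space, H)) :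
    ∫⁻ x, ‖(𝓕⁻ f) x‖ₑ ^ 2 = ∫⁻ p, ‖f p‖ₑ ^ 2 := by
  have h := integral_norm_sq_fourier (𝓕⁻ f)
  rw [FourierTransform.fourier_fourierInv_eq] at h
  have hi : ∀ g : 𝓢(Space, H), ∫⁻ x, ‖g x‖ₑ ^ 2 = ENNReal.ofReal (∫ x, ‖g x‖ ^ 2) := by
    intro g
    rw [ofReal_integral_eq_lintegral_ofReal
      ((g.memLp 2 volume).integrable_norm_pow (p := 2) (by norm_num))
      (.of_forall fun x => by positivity)]
    simp [ENNReal.ofReal_pow]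
  rw [hi, hi, h]

lemma enorm_fourierInv_le (f : 𝓢(Space, H)) (x : Space) :
    ‖(𝓕⁻ f) x‖ₑ ≤ ∫⁻ p, ‖f p‖ₑ := by
  rw [fourierInv_coe, Real.fourierInv_eq]
  refine (enorm_integral_le_lintegral_enorm _).trans (le_of_eq ?_)
  refine lintegral_congr fun p => ?_
  rw [enorm_eq_iff_norm_eq, Circle.norm_smul]

/-- A Cauchy–Schwarz bound for the low-frequency part. -/
lemma sq_setLIntegral_ball_le (g : Space → ℝ≥0∞) (hg : Measurable g) (S : ℝ) (hS : 0 ≤ S) :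
    (∫⁻ p in Metric.ball (0 : Space) S, g p) ^ 2
      ≤ 3 * volume (Metric.ball (0 : Space) 1) * ENNReal.ofReal S *
        ∫⁻ p in Metric.ball (0 : Space) S, ‖p‖ₑ ^ 2 * g p ^ 2 := by
  have hae : ∀ᵐ p ∂(volume.restrict (Metric.ball (0 : Space) S)),
      g p = ((fun p : Space => ENNReal.ofReal (‖p‖⁻¹)) * fun p : Space => ‖p‖ₑ * g p) p := by
    have : ∀ᵐ p : Space, p ≠ 0 := by simp [ae_iff]
    filter_upwards [ae_restrict_of_ae this] with p hp
    simp only [Pi.mul_apply]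
    rw [← mul_assoc, ← ofReal_norm, ← ENNReal.ofReal_mul (by positivity),
      inv_mul_cancel₀ (by simpa using hp)]
    simp
  rw [lintegral_congr_ae hae, ← lintegral_ball_inv_norm_sq S hS]
  have := ENNReal.lintegral_mul_le_Lp_mul_Lq (volume.restrict (Metric.ball (0 : Space) S))
    Real.HolderConjugate.two_two (f := fun p : Space => ENNReal.ofReal (‖p‖⁻¹))
    (g := fun p : Space => ‖p‖ₑ * g p)
    (by fun_prop) (by fun_prop)
  calc _ ≤ _ := pow_le_pow_left' this 2
    _ = _ := by
      rw [mul_pow, ← ENNReal.rpow_natCast, ← ENNReal.rpow_natCast, ← ENNReal.rpow_mul,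
        ← ENNReal.rpow_mul]
      norm_num [mul_pow, inv_pow, ← ENNReal.ofReal_pow]

/-- Splitting at frequency `1 / R`. -/
lemma setLIntegral_ball_enorm_sq_le [CompleteSpace H] (u : 𝓢(Space, H)) (x : Space) {R : ℝ}
    (hR : 0 < R) :
    ∫⁻ y in Metric.ball x R, ‖u y‖ₑ ^ 2
      ≤ 2 * ENNReal.ofReal (R ^ 3) * volume (Metric.ball (0 : Space) 1) *
          (∫⁻ p in Metric.ball (0 : Space) (2 / R), ‖𝓕 u p‖ₑ) ^ 2
        + 2 * ∫⁻ p in (Metric.ball (0 : Space) (1 / R))ᶜ, ‖𝓕 u p‖ₑ ^ 2 := by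
  let χ : ContDiffBump (0 : Space) := ⟨1 / R, 2 / R, by positivity, by gcongr; norm_num⟩
  have hχ : Function.HasTemperateGrowth χ := χ.hasCompactSupport.hasTemperateGrowth χ.contDiff
  set v : 𝓢(Space, H) := smulLeftCLM H χ (𝓕 u) with hv
  have hvp : ∀ p, v p = χ p • 𝓕 u p := fun p => by rw [hv, smulLeftCLM_apply_apply hχ]
  have hsplit : ∀ y, u y = (𝓕⁻ v) y + (𝓕⁻ (𝓕 u - v)) y := by
    intro y
    rw [← _root_.add_apply, ← FourierTransform.fourierInv_add, add_sub_cancel,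
      FourierTransform.fourierInv_fourier_eq]
  have hlow : ∫⁻ p, ‖v p‖ₑ ≤ ∫⁻ p in Metric.ball (0 : Space) (2 / R), ‖𝓕 u p‖ₑ := by
    rw [← lintegral_indicator measurableSet_ball]
    refine lintegral_mono fun p => ?_
    by_cases hp : p ∈ Metric.ball (0 : Space) (2 / R)
    · rw [Set.indicator_of_mem hp, hvp, enorm_smul]
      refine mul_le_of_le_one_left' ?_
      rw [← ofReal_norm, ENNReal.ofReal_le_one, Real.norm_of_nonneg χ.nonneg]
      exact χ.le_one
    · rw [hvp, χ.zero_of_le_dist (by simpa [χ] using hp)]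
      simp
  have hhigh : ∫⁻ p, ‖(𝓕 u - v) p‖ₑ ^ 2
      ≤ ∫⁻ p in (Metric.ball (0 : Space) (1 / R))ᶜ, ‖𝓕 u p‖ₑ ^ 2 := by
    rw [← lintegral_indicator measurableSet_ball.compl]
    refine lintegral_mono fun p => ?_
    have h1 : (𝓕 u - v) p = (1 - χ p) • 𝓕 u p := by
      rw [_root_.sub_apply, hvp, sub_smul, one_smul]
    by_cases hp : p ∈ Metric.ball (0 : Space) (1 / R)
    · rw [h1, χ.one_of_mem_closedBall (Metric.ball_subset_closedBall hp)]
      simp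
    · rw [Set.indicator_of_mem hp, h1, enorm_smul]
      gcongr
      refine mul_le_of_le_one_left' ?_
      rw [← ofReal_norm, ENNReal.ofReal_le_one,
        Real.norm_of_nonneg (by linarith [χ.le_one (x := p)])]
      linarith [χ.nonneg (x := p)]
  calc ∫⁻ y in Metric.ball x R, ‖u y‖ₑ ^ 2
      ≤ ∫⁻ y in Metric.ball x R, (2 * (∫⁻ p, ‖v p‖ₑ) ^ 2 + 2 * ‖(𝓕⁻ (𝓕 u - v)) y‖ₑ ^ 2) := by
        refine lintegral_mono fun y => ?_
        rw [hsplit y]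
        refine (enorm_add_sq_le _ _).trans ?_
        gcongr
        exact enorm_fourierInv_le v y
    _ = 2 * (∫⁻ p, ‖v p‖ₑ) ^ 2 * volume (Metric.ball x R)
        + 2 * ∫⁻ y in Metric.ball x R, ‖(𝓕⁻ (𝓕 u - v)) y‖ₑ ^ 2 := by
        rw [lintegral_add_left measurable_const, setLIntegral_const,
          lintegral_const_mul' _ _ (by simp)]
    _ ≤ 2 * (∫⁻ p, ‖v p‖ₑ) ^ 2 * volume (Metric.ball x R)
        + 2 * ∫⁻ p, ‖(𝓕 u - v) p‖ₑ ^ 2 := by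
        rw [← lintegral_enorm_sq_fourierInv (𝓕 u - v)]
        gcongr
        exact Measure.restrict_le_self
    _ ≤ _ := by
        rw [Measure.addHaar_ball _ _ hR.le, finrank_euclideanSpace, Fintype.card_fin]
        calc _ ≤ 2 * (∫⁻ p in Metric.ball (0 : Space) (2 / R), ‖𝓕 u p‖ₑ) ^ 2 *
              (ENNReal.ofReal (R ^ 3) * volume (Metric.ball (0 : Space) 1))
              + 2 * ∫⁻ p in (Metric.ball (0 : Space) (1 / R))ᶜ, ‖𝓕 u p‖ₑ ^ 2 := by gcongr
          _ = _ := by ring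

lemma lintegral_Ioi_inv_sq {r : ℝ} (hr : 0 < r) :
    ∫⁻ R in Set.Ioi r, ENNReal.ofReal ((R ^ 2)⁻¹) = ENNReal.ofReal r⁻¹ := by
  have h0 : ∀ R ∈ Set.Ioi r, R ^ (-2 : ℝ) = (R ^ 2)⁻¹ := fun R hR => by
    rw [Real.rpow_neg (hr.trans hR).le]; norm_num
  have hi := integrableOn_Ioi_rpow_of_lt (a := -2) (by norm_num) hr
  have hv := integral_Ioi_rpow_of_lt (a := -2) (by norm_num) hr
  rw [integrableOn_congr_fun h0 measurableSet_Ioi] at hi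
  rw [setIntegral_congr_fun measurableSet_Ioi h0] at hv
  rw [← ofReal_integral_eq_lintegral_ofReal hi (.of_forall fun R => by positivity), hv]
  norm_num [Real.rpow_neg_one]

/-- The constant in the fractional Hardy (Kato) inequality `lintegral_enorm_sq_div_norm_le`. -/
def katoConst : ℝ≥0∞ := 24 * volume (Metric.ball (0 : Space) 1) ^ 2 + 2

lemma katoConst_ne_top : katoConst ≠ ∞ := by
  have : volume (Metric.ball (0 : Space) 1) ≠ ∞ := measure_ball_lt_top.ne
  unfold katoConst
  finiteness

lemma inv_sq_mul_setLIntegral_ball_le [CompleteSpace H] (u : 𝓢(Space, H)) (x : Space) {R : ℝ}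
    (hR : 0 < R) :
    ENNReal.ofReal ((R ^ 2)⁻¹) * ∫⁻ y in Metric.ball x R, ‖u y‖ₑ ^ 2
      ≤ ∫⁻ p, ((if ‖p‖ < 2 / R then
            12 * volume (Metric.ball (0 : Space) 1) ^ 2 * (‖p‖ₑ ^ 2 * ‖𝓕 u p‖ₑ ^ 2) else 0)
          + if 1 / R ≤ ‖p‖ then 2 * ENNReal.ofReal ((R ^ 2)⁻¹) * ‖𝓕 u p‖ₑ ^ 2 else 0) := by
  have hb : volume (Metric.ball (0 : Space) 1) ≠ ∞ := measure_ball_lt_top.ne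
  have hm : Measurable fun p => ‖𝓕 u p‖ₑ := (𝓕 u).continuous.enorm.measurable
  have e1 : ∫⁻ p : Space, (if ‖p‖ < 2 / R then
      12 * volume (Metric.ball (0 : Space) 1) ^ 2 * (‖p‖ₑ ^ 2 * ‖𝓕 u p‖ₑ ^ 2) else 0)
      = 12 * volume (Metric.ball (0 : Space) 1) ^ 2 *
        ∫⁻ p in Metric.ball (0 : Space) (2 / R), ‖p‖ₑ ^ 2 * ‖𝓕 u p‖ₑ ^ 2 := by
    rw [← lintegral_const_mul' _ _ (by finiteness), ← lintegral_indicator measurableSet_ball]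
    refine lintegral_congr fun p => ?_
    simp [Set.indicator]
  have e2 : ∫⁻ p : Space, (if 1 / R ≤ ‖p‖ then
      2 * ENNReal.ofReal ((R ^ 2)⁻¹) * ‖𝓕 u p‖ₑ ^ 2 else 0)
      = 2 * ENNReal.ofReal ((R ^ 2)⁻¹) *
        ∫⁻ p in (Metric.ball (0 : Space) (1 / R))ᶜ, ‖𝓕 u p‖ₑ ^ 2 := by
    rw [← lintegral_const_mul' _ _ (by finiteness), ← lintegral_indicator measurableSet_ball.compl]
    refine lintegral_congr fun p => ?_
    simp [Set.indicator]
  rw [lintegral_add_right _ (Measurable.ite (measurableSet_le measurable_const measurable_norm)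
    (by fun_prop) measurable_const), e1, e2]
  calc _ ≤ ENNReal.ofReal ((R ^ 2)⁻¹) *
        (2 * ENNReal.ofReal (R ^ 3) * volume (Metric.ball (0 : Space) 1) *
          (3 * volume (Metric.ball (0 : Space) 1) * ENNReal.ofReal (2 / R) *
            ∫⁻ p in Metric.ball (0 : Space) (2 / R), ‖p‖ₑ ^ 2 * ‖𝓕 u p‖ₑ ^ 2)
        + 2 * ∫⁻ p in (Metric.ball (0 : Space) (1 / R))ᶜ, ‖𝓕 u p‖ₑ ^ 2) := by
        gcongr
        refine (setLIntegral_ball_enorm_sq_le u x hR).trans ?_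
        gcongr
        exact sq_setLIntegral_ball_le _ hm _ (by positivity)
    _ = 6 * (ENNReal.ofReal ((R ^ 2)⁻¹) * ENNReal.ofReal (R ^ 3) * ENNReal.ofReal (2 / R)) *
          volume (Metric.ball (0 : Space) 1) ^ 2 *
          (∫⁻ p in Metric.ball (0 : Space) (2 / R), ‖p‖ₑ ^ 2 * ‖𝓕 u p‖ₑ ^ 2)
        + 2 * ENNReal.ofReal ((R ^ 2)⁻¹) *
          ∫⁻ p in (Metric.ball (0 : Space) (1 / R))ᶜ, ‖𝓕 u p‖ₑ ^ 2 := by ring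
    _ = _ := by
        rw [← ENNReal.ofReal_mul (by positivity), ← ENNReal.ofReal_mul (by positivity)]
        have : (R ^ 2)⁻¹ * R ^ 3 * (2 / R) = 2 := by field_simp
        rw [this, ENNReal.ofReal_ofNat]
        norm_num

/-- Integrating over all scales the weight attached to a single frequency. -/
lemma lintegral_scale_weight_le (p : Space) (F : ℝ≥0∞) :
    ∫⁻ R in Set.Ioi (0 : ℝ), ((if ‖p‖ < 2 / R then
            12 * volume (Metric.ball (0 : Space) 1) ^ 2 * (‖p‖ₑ ^ 2 * F) else 0)
          + if 1 / R ≤ ‖p‖ then 2 * ENNReal.ofReal ((R ^ 2)⁻¹) * F else 0)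
      ≤ katoConst * (‖p‖ₑ * F) := by
  rcases eq_or_ne p 0 with rfl | hp
  · refine le_of_eq_of_le ?_ zero_le
    rw [setLIntegral_congr_fun (g := 0) measurableSet_Ioi]
    · simp
    · intro R (hR : 0 < R)
      simp [hR]
  have hp' : 0 < ‖p‖ := norm_pos_iff.2 hp
  have hb : volume (Metric.ball (0 : Space) 1) ≠ ∞ := measure_ball_lt_top.ne
  have hf : ∀ R ∈ Set.Ioi (0 : ℝ), ((if ‖p‖ < 2 / R then
            12 * volume (Metric.ball (0 : Space) 1) ^ 2 * (‖p‖ₑ ^ 2 * F) else 0)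
          + if 1 / R ≤ ‖p‖ then 2 * ENNReal.ofReal ((R ^ 2)⁻¹) * F else 0)
      = (Set.Iio (2 / ‖p‖)).indicator
          (fun _ => 12 * volume (Metric.ball (0 : Space) 1) ^ 2 * (‖p‖ₑ ^ 2 * F)) R
        + (Set.Ici ‖p‖⁻¹).indicator (fun R => ENNReal.ofReal ((R ^ 2)⁻¹) * (2 * F)) R := by
    intro R (hR : 0 < R)
    have h1 : ‖p‖ < 2 / R ↔ R < 2 / ‖p‖ := by rw [lt_div_iff₀ hR, lt_div_iff₀ hp', mul_comm]
    have h2 : 1 / R ≤ ‖p‖ ↔ ‖p‖⁻¹ ≤ R := by rw [one_div, inv_le_comm₀ hR hp']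
    simp only [h1, h2, Set.indicator, Set.mem_Iio, Set.mem_Ici]
    congr 2
    ring
  rw [setLIntegral_congr_fun measurableSet_Ioi hf,
    lintegral_add_left (measurable_const.indicator measurableSet_Iio)]
  have t1 : ∫⁻ R in Set.Ioi (0 : ℝ), (Set.Iio (2 / ‖p‖)).indicator
      (fun _ => 12 * volume (Metric.ball (0 : Space) 1) ^ 2 * (‖p‖ₑ ^ 2 * F)) R
      = 24 * volume (Metric.ball (0 : Space) 1) ^ 2 * (‖p‖ₑ * F) := by
    rw [lintegral_indicator measurableSet_Iio, Measure.restrict_restrict measurableSet_Iio,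
      Set.Iio_inter_Ioi, setLIntegral_const, Real.volume_Ioo, sub_zero]
    have : ‖p‖ₑ * ENNReal.ofReal (2 / ‖p‖) = 2 := by
      rw [← ofReal_norm, ← ENNReal.ofReal_mul hp'.le, mul_div_cancel₀ _ hp'.ne',
        ENNReal.ofReal_ofNat]
    calc _ = 12 * volume (Metric.ball (0 : Space) 1) ^ 2 *
          (‖p‖ₑ * (‖p‖ₑ * ENNReal.ofReal (2 / ‖p‖)) * F) := by ring
      _ = _ := by rw [this]; ring
  have t2 : ∫⁻ R in Set.Ioi (0 : ℝ), (Set.Ici ‖p‖⁻¹).indicator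
      (fun R => ENNReal.ofReal ((R ^ 2)⁻¹) * (2 * F)) R ≤ 2 * (‖p‖ₑ * F) := by
    rw [lintegral_indicator measurableSet_Ici, Measure.restrict_restrict measurableSet_Ici]
    refine (lintegral_mono_set Set.inter_subset_left).trans ?_
    rw [setLIntegral_congr Ioi_ae_eq_Ici.symm, lintegral_mul_const _ (by fun_prop),
      lintegral_Ioi_inv_sq (inv_pos.2 hp'), inv_inv, ofReal_norm]
    exact le_of_eq (by ring)
  rw [t1, katoConst, add_mul]
  gcongr

/-- A fractional Hardy (Kato) inequality:
`∫ ‖u(y)‖² / |x - y| dy ≤ C ∫ |p| ‖û(p)‖² dp`. -/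
theorem lintegral_enorm_sq_div_norm_le [CompleteSpace H] (u : 𝓢(Space, H)) (x : Space) :
    ∫⁻ y, ENNReal.ofReal ‖x - y‖⁻¹ * ‖u y‖ₑ ^ 2 ≤ katoConst * ∫⁻ p, ‖p‖ₑ * ‖𝓕 u p‖ₑ ^ 2 := by
  have hu : Measurable fun p => ‖u p‖ₑ := u.continuous.enorm.measurable
  have hm : Measurable fun p => ‖𝓕 u p‖ₑ := (𝓕 u).continuous.enorm.measurable
  calc ∫⁻ y, ENNReal.ofReal ‖x - y‖⁻¹ * ‖u y‖ₑ ^ 2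
      ≤ ∫⁻ y, ∫⁻ R in Set.Ioi (0 : ℝ),
          if ‖x - y‖ < R then ENNReal.ofReal ((R ^ 2)⁻¹) * ‖u y‖ₑ ^ 2 else 0 := by
        refine lintegral_mono fun y => ?_
        rcases eq_or_lt_of_le (norm_nonneg (x - y)) with h | h
        · simp [← h]
        rw [← lintegral_Ioi_inv_sq h, ← lintegral_mul_const _ (by fun_prop),
          ← lintegral_indicator measurableSet_Ioi, ← lintegral_indicator measurableSet_Ioi]
        refine lintegral_mono fun R => ?_
        by_cases hR : ‖x - y‖ < R
        · simp [hR, h.trans hR]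
        · simp [hR]
    _ = ∫⁻ R in Set.Ioi (0 : ℝ), ∫⁻ y,
          if ‖x - y‖ < R then ENNReal.ofReal ((R ^ 2)⁻¹) * ‖u y‖ₑ ^ 2 else 0 := by
        refine lintegral_lintegral_swap (Measurable.aemeasurable ?_)
        exact Measurable.ite (measurableSet_lt (by fun_prop) (by fun_prop))
          (Measurable.mul (by fun_prop) ((hu.comp measurable_fst).pow_const 2)) measurable_const
    _ ≤ ∫⁻ R in Set.Ioi (0 : ℝ), ∫⁻ p, ((if ‖p‖ < 2 / R then
            12 * volume (Metric.ball (0 : Space) 1) ^ 2 * (‖p‖ₑ ^ 2 * ‖𝓕 u p‖ₑ ^ 2) else 0)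
          + if 1 / R ≤ ‖p‖ then 2 * ENNReal.ofReal ((R ^ 2)⁻¹) * ‖𝓕 u p‖ₑ ^ 2 else 0) := by
        refine setLIntegral_mono' measurableSet_Ioi fun R hR => ?_
        refine le_trans (le_of_eq ?_) (inv_sq_mul_setLIntegral_ball_le u x hR)
        rw [← lintegral_const_mul' _ _ (by finiteness), ← lintegral_indicator measurableSet_ball]
        refine lintegral_congr fun y => ?_
        simp [Set.indicator, dist_eq_norm, norm_sub_rev]
    _ = ∫⁻ p, ∫⁻ R in Set.Ioi (0 : ℝ), ((if ‖p‖ < 2 / R then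
            12 * volume (Metric.ball (0 : Space) 1) ^ 2 * (‖p‖ₑ ^ 2 * ‖𝓕 u p‖ₑ ^ 2) else 0)
          + if 1 / R ≤ ‖p‖ then 2 * ENNReal.ofReal ((R ^ 2)⁻¹) * ‖𝓕 u p‖ₑ ^ 2 else 0) := by
        refine lintegral_lintegral_swap (Measurable.aemeasurable ?_)
        have hm' : Measurable fun z : ℝ × Space => ‖𝓕 u z.2‖ₑ ^ 2 :=
          (hm.comp measurable_snd).pow_const 2
        exact (Measurable.ite (measurableSet_lt (by fun_prop) (by fun_prop))
          (Measurable.mul (by fun_prop) (Measurable.mul (by fun_prop) hm')) measurable_const).add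
          (Measurable.ite (measurableSet_le (by fun_prop) (by fun_prop))
          (Measurable.mul (by fun_prop) hm') measurable_const)
    _ ≤ ∫⁻ p, katoConst * (‖p‖ₑ * ‖𝓕 u p‖ₑ ^ 2) :=
        lintegral_mono fun p => lintegral_scale_weight_le p _
    _ = _ := lintegral_const_mul' _ _ katoConst_ne_top

end FractionalHardy

section Kinetic

lemma lintegral_sum_const_mul_lintegral_swap {ι : Type*} [Fintype ι] {K : ℝ≥0∞} (hK : K ≠ ∞)
    (f : ι → Space → Space → ℝ≥0∞)
    (hf : ∀ i, Measurable fun z : Space × Space => f i z.1 z.2) :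
    ∫⁻ x, ∑ i, K * ∫⁻ p, f i x p = K * ∫⁻ p, ∫⁻ x, ∑ i, f i x p := by
  have hsum : Measurable (Function.uncurry fun x p => ∑ i, f i x p) :=
    Finset.measurable_sum _ fun i _ => hf i
  rw [← lintegral_lintegral_swap hsum.aemeasurable, ← lintegral_const_mul' _ _ hK]
  refine lintegral_congr fun x => ?_
  have hx (i : ι) : Measurable fun p => f i x p := (hf i).comp measurable_prodMk_left
  rw [lintegral_finsetSum _ fun i _ => hx i, Finset.mul_sum]

lemma le_relativistic_kinetic_add {s c r : ℝ} (hs : 0 < s) (hsc : s ≤ c) :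
    r ≤ 2 / s * (√(c ^ 2 * r ^ 2 + c ^ 4) - c ^ 2) + s / 2 := by
  have hc : 0 < c := hs.trans_le hsc
  set w := √(c ^ 2 * r ^ 2 + c ^ 4) with hw
  have hw2 : w ^ 2 = c ^ 2 * r ^ 2 + c ^ 4 := Real.sq_sqrt (by positivity)
  have hT : 0 ≤ w - c ^ 2 := by
    rw [sub_nonneg]
    exact Real.le_sqrt_of_sq_le (by nlinarith [sq_nonneg (c * r)])
  set T := w - c ^ 2
  have hcr : c ^ 2 * r ^ 2 = T ^ 2 + 2 * T * c ^ 2 := by simp only [T]; linarith [hw2]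
  have h1 : (s * r) ^ 2 ≤ (2 * T + s ^ 2 / 2) ^ 2 := by
    have hs2 : s ^ 2 ≤ c ^ 2 := by gcongr
    have h2 : (s * r) ^ 2 = s ^ 2 / c ^ 2 * T ^ 2 + 2 * T * s ^ 2 := by
      field_simp
      linear_combination hcr
    have h3 : s ^ 2 / c ^ 2 * T ^ 2 ≤ T ^ 2 :=
      mul_le_of_le_one_left (by positivity) ((div_le_one (by positivity)).2 hs2)
    nlinarith [sq_nonneg T, sq_nonneg (s ^ 2)]
  have h4 : s * r ≤ 2 * T + s ^ 2 / 2 := abs_le_of_sq_le_sq' h1 (by positivity) |>.2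
  have h5 : 2 / s * T + s / 2 = (2 * T + s ^ 2 / 2) / s := by field_simp
  rw [h5, le_div_iff₀ hs]
  linarith

variable {H : Type*} [NormedAddCommGroup H] [NormedSpace ℝ H]

lemma integrable_relativistic_kinetic {c : ℝ} (hc : 0 ≤ c) (f : 𝓢(Space, H)) :
    Integrable fun p : Space => (√(c ^ 2 * ‖p‖ ^ 2 + c ^ 4) - c ^ 2) * ‖f p‖ ^ 2 := by
  have hf := f.continuous
  refine Integrable.mono' ((f.integrable_pow_mul volume 1).const_mul
    (c * SchwartzMap.seminorm ℝ 0 0 f)) (by fun_prop) (.of_forall fun p => ?_)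
  have h1 : c ^ 2 ≤ √(c ^ 2 * ‖p‖ ^ 2 + c ^ 4) :=
    Real.le_sqrt_of_sq_le (by nlinarith [sq_nonneg (c * ‖p‖)])
  have h2 : √(c ^ 2 * ‖p‖ ^ 2 + c ^ 4) ≤ c * ‖p‖ + c ^ 2 :=
    Real.sqrt_le_iff.2 ⟨by positivity, by
      nlinarith [mul_nonneg (mul_nonneg hc (norm_nonneg p)) (sq_nonneg c)]⟩
  have h3 := SchwartzMap.norm_le_seminorm ℝ f p
  rw [Real.norm_of_nonneg (mul_nonneg (sub_nonneg.2 h1) (by positivity))]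
  calc _ ≤ (c * ‖p‖) * (SchwartzMap.seminorm ℝ 0 0 f * ‖f p‖) := by
        rw [sq ‖f p‖]
        gcongr
        linarith
    _ = _ := by ring

lemma lintegral_norm_mul_enorm_sq_le {s c : ℝ} (hs : 0 < s) (hsc : s ≤ c) (f : 𝓢(Space, H)) :
    ∫⁻ p, ‖p‖ₑ * ‖f p‖ₑ ^ 2 ≤ ENNReal.ofReal
      (2 / s * (∫ p, (√(c ^ 2 * ‖p‖ ^ 2 + c ^ 4) - c ^ 2) * ‖f p‖ ^ 2)
        + s / 2 * ∫ p, ‖f p‖ ^ 2) := by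
  have hi1 := (integrable_relativistic_kinetic (hs.trans_le hsc).le f).const_mul (2 / s)
  have hi2 := (((f.memLp 2 volume).integrable_norm_pow (p := 2) (by norm_num))).const_mul (s / 2)
  have hle : ∀ p : Space, ‖p‖ * ‖f p‖ ^ 2 ≤
      2 / s * ((√(c ^ 2 * ‖p‖ ^ 2 + c ^ 4) - c ^ 2) * ‖f p‖ ^ 2) + s / 2 * ‖f p‖ ^ 2 := by
    intro p
    rw [← mul_assoc, ← add_mul]
    gcongr
    exact le_relativistic_kinetic_add hs hsc
  have hi : Integrable fun p => 2 / s * ((√(c ^ 2 * ‖p‖ ^ 2 + c ^ 4) - c ^ 2) * ‖f p‖ ^ 2)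
      + s / 2 * ‖f p‖ ^ 2 := hi1.add hi2
  rw [← integral_const_mul, ← integral_const_mul, ← integral_add hi1 hi2,
    ofReal_integral_eq_lintegral_ofReal hi
      (.of_forall fun p => (by positivity : 0 ≤ ‖p‖ * ‖f p‖ ^ 2).trans (hle p))]
  refine lintegral_mono fun p => ?_
  rw [← ofReal_norm, ← ofReal_norm, ← ENNReal.ofReal_pow (norm_nonneg _),
    ← ENNReal.ofReal_mul (norm_nonneg _)]
  exact ENNReal.ofReal_le_ofReal (hle p)

end Kinetic

namespace OrbitalData

lemma integrable_inner (Γ : OrbitalData) (m n : ℕ) :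
    Integrable fun x => (inner ℂ (Γ.xi m x) (Γ.xi n x) : ℂ) := by
  refine (L2.integrable_inner (𝕜 := ℂ) ((Γ.xi m).toLp 2) ((Γ.xi n).toLp 2)).congr ?_
  filter_upwards [(Γ.xi m).coeFn_toLp 2, (Γ.xi n).coeFn_toLp 2] with x hm hn
  rw [hm, hn]

lemma integral_norm_sq_fourier_eq_one (Γ : OrbitalData) (n : ℕ) :
    ∫ p, ‖Γ.fourier n p‖ ^ 2 = 1 := by
  have h := Γ.orthonormal n n
  rw [if_pos rfl] at h
  have h2 : ∫ x, ‖Γ.xi n x‖ ^ 2 = 1 := by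
    have : ∀ x, (inner ℂ (Γ.xi n x) (Γ.xi n x) : ℂ) = ((‖Γ.xi n x‖ ^ 2 : ℝ) : ℂ) := fun x => by
      rw [inner_self_eq_norm_sq_to_K]; norm_cast
    simp_rw [this] at h
    rw [integral_complex_ofReal] at h
    exact_mod_cast h
  rw [← h2]
  exact SchwartzMap.integral_norm_sq_fourier (Γ.xi n)

lemma sum_norm_sq_conj_smul (Γ : OrbitalData) (N : ℕ) (a : ℕ → Spinor) (x : Space) :
    ((∑ σ : Fin 4, ‖∑ n ∈ Finset.range N, starRingEnd ℂ (Γ.xi n x σ) • a n‖ ^ 2 : ℝ) : ℂ)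
      = ∑ m ∈ Finset.range N, ∑ n ∈ Finset.range N,
          inner ℂ (Γ.xi n x) (Γ.xi m x) * inner ℂ (a m) (a n) := by
  push_cast
  have h : ∀ v : Spinor, (‖v‖ : ℂ) ^ 2 = inner ℂ v v := fun v =>
    (inner_self_eq_norm_sq_to_K v).symm
  simp_rw [h, sum_inner, inner_sum, inner_smul_left, inner_smul_right, RingHomCompTriple.comp_apply,
    RingHom.id_apply]
  rw [Finset.sum_comm]
  refine Finset.sum_congr rfl fun m _ => ?_
  rw [Finset.sum_comm]
  refine Finset.sum_congr rfl fun n _ => ?_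
  rw [PiLp.inner_apply (Γ.xi n x), Finset.sum_mul]
  refine Finset.sum_congr rfl fun σ _ => ?_
  simp
  ring

/-- Orthonormality, tested against arbitrary coefficient vectors. -/
lemma lintegral_sum_enorm_sq_conj_smul (Γ : OrbitalData) (N : ℕ) (a : ℕ → Spinor) :
    ∫⁻ x, ∑ σ : Fin 4, ‖∑ n ∈ Finset.range N, starRingEnd ℂ (Γ.xi n x σ) • a n‖ₑ ^ 2
      = ∑ n ∈ Finset.range N, ‖a n‖ₑ ^ 2 := by
  set F : Space → ℝ := fun x =>
    ∑ σ : Fin 4, ‖∑ n ∈ Finset.range N, starRingEnd ℂ (Γ.xi n x σ) • a n‖ ^ 2 with hF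
  have hFi : Integrable fun x => (F x : ℂ) := by
    simp_rw [hF, sum_norm_sq_conj_smul]
    exact integrable_finsetSum _ fun m _ => integrable_finsetSum _ fun n _ =>
      (Γ.integrable_inner n m).mul_const _
  have hint : ∫ x, F x = ∑ n ∈ Finset.range N, ‖a n‖ ^ 2 := by
    have : ((∫ x, F x : ℝ) : ℂ) = ((∑ n ∈ Finset.range N, ‖a n‖ ^ 2 : ℝ) : ℂ) := by
      rw [← integral_complex_ofReal]
      simp_rw [hF, sum_norm_sq_conj_smul]
      rw [integral_finsetSum _ fun m _ => integrable_finsetSum _ fun n _ =>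
        (Γ.integrable_inner n m).mul_const _]
      push_cast
      refine Finset.sum_congr rfl fun m hm => ?_
      rw [integral_finsetSum _ fun n _ => (Γ.integrable_inner n m).mul_const _]
      simp_rw [integral_mul_const, Γ.orthonormal, ite_mul, one_mul, zero_mul]
      rw [Finset.sum_ite_eq', if_pos hm]
      exact inner_self_eq_norm_sq_to_K _
    exact_mod_cast this
  have h1 := ofReal_integral_eq_lintegral_ofReal (f := F) (by simpa using hFi.re)
    (.of_forall fun x => Finset.sum_nonneg fun σ _ => by positivity)
  rw [hint] at h1
  have e : ∀ v : Spinor, ‖v‖ₑ ^ 2 = ENNReal.ofReal (‖v‖ ^ 2) := fun v => by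
    rw [ENNReal.ofReal_pow (norm_nonneg _), ofReal_norm]
  simp_rw [e]
  rw [← ENNReal.ofReal_sum_of_nonneg (fun _ _ => by positivity), h1]
  refine lintegral_congr fun x => ?_
  rw [← ENNReal.ofReal_sum_of_nonneg (fun _ _ => by positivity)]

variable {Γ : OrbitalData} {N : ℕ}

lemma kernel_eq_sum (hlam : ∀ n : ℕ, Γ.lam n = if n < N then 1 else 0) (x y : Space)
    (σ τ : Fin 4) :
    Γ.kernel x y σ τ = ∑ n ∈ Finset.range N, Γ.xi n x σ * starRingEnd ℂ (Γ.xi n y τ) := by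
  rw [kernel, tsum_eq_sum (s := Finset.range N)]
  · refine Finset.sum_congr rfl fun n hn => ?_
    simp [hlam, Finset.mem_range.1 hn]
  · intro n hn
    simp [hlam, Finset.mem_range.not.1 hn]

lemma trKinetic_eq_sum (hlam : ∀ n : ℕ, Γ.lam n = if n < N then 1 else 0) (c : ℝ) :
    Γ.trKinetic c = ∑ n ∈ Finset.range N,
      ∫ p : Space, (√(c ^ 2 * ‖p‖ ^ 2 + c ^ 4) - c ^ 2) * ‖Γ.fourier n p‖ ^ 2 := by
  rw [trKinetic, tsum_eq_sum (s := Finset.range N)]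
  · refine Finset.sum_congr rfl fun n hn => ?_
    simp [hlam, Finset.mem_range.1 hn]
  · intro n hn
    simp [hlam, Finset.mem_range.not.1 hn]

/-- The slice `y ↦ conj (γ(x,σ;y,·))` of a rank-`N` projection, as a Schwartz function. -/
def slice (Γ : OrbitalData) (N : ℕ) (x : Space) (σ : Fin 4) : 𝓢(Space, Spinor) :=
  ∑ n ∈ Finset.range N, starRingEnd ℂ (Γ.xi n x σ) • Γ.xi n

lemma slice_apply (x y : Space) (σ : Fin 4) :
    Γ.slice N x σ y = ∑ n ∈ Finset.range N, starRingEnd ℂ (Γ.xi n x σ) • Γ.xi n y := by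
  simp [slice]

lemma fourier_slice_apply (x p : Space) (σ : Fin 4) :
    𝓕 (Γ.slice N x σ) p
      = ∑ n ∈ Finset.range N, starRingEnd ℂ (Γ.xi n x σ) • Γ.fourier n p := by
  have : 𝓕 (Γ.slice N x σ) = fourierTransformCLM ℂ (Γ.slice N x σ) := rfl
  rw [this, slice, map_sum]
  simp [fourier]

lemma sum_norm_sq_kernel (hlam : ∀ n : ℕ, Γ.lam n = if n < N then 1 else 0) (x y : Space) :
    ∑ σ : Fin 4, ∑ τ : Fin 4, ‖Γ.kernel x y σ τ‖ ^ 2 = ∑ σ : Fin 4, ‖Γ.slice N x σ y‖ ^ 2 := by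
  refine Finset.sum_congr rfl fun σ _ => ?_
  rw [EuclideanSpace.norm_sq_eq]
  refine Finset.sum_congr rfl fun τ _ => ?_
  rw [kernel_eq_sum hlam, slice_apply, ← RCLike.norm_conj]
  simp [map_sum]

lemma measurable_enorm_fourier_slice (Γ : OrbitalData) (N : ℕ) (σ : Fin 4) :
    Measurable fun z : Space × Space => ‖z.2‖ₑ * ‖𝓕 (Γ.slice N z.1 σ) z.2‖ₑ ^ 2 := by
  simp_rw [fourier_slice_apply]
  refine Measurable.mul (by fun_prop) (Measurable.pow_const (Measurable.enorm ?_) 2)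
  refine Finset.measurable_sum _ fun n _ => ?_
  have hxi : Measurable fun x => Γ.xi n x σ := by
    have := (Γ.xi n).continuous
    exact Continuous.measurable (by fun_prop)
  have hconj : Measurable fun z : Space × Space => starRingEnd ℂ (Γ.xi n z.1 σ) :=
    RCLike.continuous_conj.measurable.comp (hxi.comp measurable_fst)
  exact hconj.smul ((Γ.fourier n).continuous.measurable.comp measurable_snd)

/-- The exchange energy of a projection is controlled by its massless kinetic energy. -/
lemma enorm_exchange_le (hlam : ∀ n : ℕ, Γ.lam n = if n < N then 1 else 0) :
    ‖Γ.exchange‖ₑ ≤ katoConst * ∑ n ∈ Finset.range N, ∫⁻ p, ‖p‖ₑ * ‖Γ.fourier n p‖ₑ ^ 2 := by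
  calc ‖Γ.exchange‖ₑ
      ≤ ‖∫ x : Space, ∫ y : Space,
          (∑ σ : Fin 4, ∑ τ : Fin 4, ‖Γ.kernel x y σ τ‖ ^ 2) / ‖x - y‖‖ₑ := by
        rw [exchange, enorm_mul]
        refine mul_le_of_le_one_left' ?_
        rw [← ofReal_norm, ENNReal.ofReal_le_one]
        norm_num
    _ ≤ ∫⁻ x : Space, ∫⁻ y : Space,
          ‖(∑ σ : Fin 4, ∑ τ : Fin 4, ‖Γ.kernel x y σ τ‖ ^ 2) / ‖x - y‖‖ₑ :=
        (enorm_integral_le_lintegral_enorm _).trans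
          (lintegral_mono fun x => enorm_integral_le_lintegral_enorm _)
    _ = ∫⁻ x : Space, ∑ σ : Fin 4, ∫⁻ y : Space,
          ENNReal.ofReal ‖x - y‖⁻¹ * ‖Γ.slice N x σ y‖ₑ ^ 2 := by
        refine lintegral_congr fun x => ?_
        rw [← lintegral_finsetSum]
        · refine lintegral_congr fun y => ?_
          rw [sum_norm_sq_kernel hlam, ← Finset.mul_sum, div_eq_inv_mul, enorm_mul,
            Real.enorm_of_nonneg (by positivity), Real.enorm_of_nonneg (by positivity),
            ENNReal.ofReal_sum_of_nonneg (fun _ _ => by positivity)]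
          simp [ENNReal.ofReal_pow]
        · intro σ _
          have := (Γ.slice N x σ).continuous.enorm.measurable
          fun_prop
    _ ≤ ∫⁻ x : Space, ∑ σ : Fin 4, katoConst * ∫⁻ p, ‖p‖ₑ * ‖𝓕 (Γ.slice N x σ) p‖ₑ ^ 2 := by
        gcongr with x σ
        exact lintegral_enorm_sq_div_norm_le _ x
    _ = katoConst * ∫⁻ p, ∫⁻ x : Space, ∑ σ : Fin 4, ‖p‖ₑ * ‖𝓕 (Γ.slice N x σ) p‖ₑ ^ 2 :=
        lintegral_sum_const_mul_lintegral_swap katoConst_ne_top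
          (fun σ x p => ‖p‖ₑ * ‖𝓕 (Γ.slice N x σ) p‖ₑ ^ 2) (measurable_enorm_fourier_slice Γ N)
    _ = katoConst * ∫⁻ p, ∑ n ∈ Finset.range N, ‖p‖ₑ * ‖Γ.fourier n p‖ₑ ^ 2 := by
        congr 1
        refine lintegral_congr fun p => ?_
        simp_rw [← Finset.mul_sum, fourier_slice_apply]
        rw [lintegral_const_mul' _ _ (by simp), lintegral_sum_enorm_sq_conj_smul]
    _ = _ := by
        have h (n : ℕ) : Measurable fun p => ‖p‖ₑ * ‖Γ.fourier n p‖ₑ ^ 2 := by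
          have := (Γ.fourier n).continuous.enorm.measurable
          fun_prop
        rw [lintegral_finsetSum _ fun n _ => h n]

lemma exchange_le (hlam : ∀ n : ℕ, Γ.lam n = if n < N then 1 else 0) {s c : ℝ} (hs : 0 < s)
    (hsc : s ≤ c) :
    Γ.exchange ≤ katoConst.toReal * (2 / s * Γ.trKinetic c + s / 2 * N) := by
  have hT : ∀ n, 0 ≤ ∫ p : Space, (√(c ^ 2 * ‖p‖ ^ 2 + c ^ 4) - c ^ 2) * ‖Γ.fourier n p‖ ^ 2 :=
    fun n => integral_nonneg fun p => mul_nonneg (sub_nonneg.2 (Real.le_sqrt_of_sq_le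
      (by nlinarith [sq_nonneg (c * ‖p‖)]))) (by positivity)
  have hsum : ∑ n ∈ Finset.range N, (2 / s *
      (∫ p : Space, (√(c ^ 2 * ‖p‖ ^ 2 + c ^ 4) - c ^ 2) * ‖Γ.fourier n p‖ ^ 2) + s / 2)
      = 2 / s * Γ.trKinetic c + s / 2 * N := by
    rw [Finset.sum_add_distrib, ← Finset.mul_sum, ← trKinetic_eq_sum hlam]
    simp [mul_comm]
  have hnn : 0 ≤ 2 / s * Γ.trKinetic c + s / 2 * N := by
    rw [← hsum]
    exact Finset.sum_nonneg fun n _ => by have := hT n; positivity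
  have key : ‖Γ.exchange‖ₑ
      ≤ ENNReal.ofReal (katoConst.toReal * (2 / s * Γ.trKinetic c + s / 2 * N)) := by
    rw [ENNReal.ofReal_mul ENNReal.toReal_nonneg, ENNReal.ofReal_toReal katoConst_ne_top, ← hsum,
      ENNReal.ofReal_sum_of_nonneg fun n _ => by have := hT n; positivity]
    refine (enorm_exchange_le hlam).trans ?_
    gcongr with n
    have := lintegral_norm_mul_enorm_sq_le hs hsc (Γ.fourier n)
    rwa [integral_norm_sq_fourier_eq_one, mul_one] at this
  rw [← ofReal_norm, ENNReal.ofReal_le_ofReal_iff (by positivity)] at key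
  exact (Real.le_norm_self _).trans key

end OrbitalData

/-- For every `κ ∈ (0,1)` and all `A, B > 0` there is `C > 0` such
that: for every `Z ≥ 1`, setting `c := Z/κ`, every `N ∈ ℕ` with `N ≤ A·Z`, and every
rank-`N` projection orbital data (`λ_1 = ⋯ = λ_N = 1`, `λ_n = 0` for `n > N`) with
`tr(T_cγ) ≤ B·Z^{7/3}`, the exchange energy satisfies `𝒳[γ] ≤ C·Z^{5/3}`. -/
theorem exchange_energy_projection_bound (κ : ℝ) (hκ : κ ∈ Set.Ioo (0 : ℝ) 1)
    (A B : ℝ) (hA : 0 < A) (hB : 0 < B) :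
    ∃ C : ℝ, 0 < C ∧ ∀ Z : ℝ, 1 ≤ Z → ∀ N : ℕ, (N : ℝ) ≤ A * Z →
      ∀ Γ : OrbitalData,
      (∀ n : ℕ, Γ.lam n = if n < N then 1 else 0) →
      Γ.trKinetic (Z / κ) ≤ B * Z ^ ((7 : ℝ) / 3) →
      Γ.exchange ≤ C * Z ^ ((5 : ℝ) / 3) := by
  refine ⟨(katoConst.toReal + 1) * (2 * B + A / 2), by positivity, ?_⟩
  intro Z hZ N hN Γ hlam hkin
  have hZ0 : 0 < Z := one_pos.trans_le hZ
  have hsc : Z ^ ((2 : ℝ) / 3) ≤ Z / κ :=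
    calc Z ^ ((2 : ℝ) / 3) ≤ Z ^ (1 : ℝ) := Real.rpow_le_rpow_of_exponent_le hZ (by norm_num)
      _ = Z := Real.rpow_one Z
      _ ≤ Z / κ := le_div_self hZ0.le hκ.1 hκ.2.le
  have hs : 0 < Z ^ ((2 : ℝ) / 3) := by positivity
  have h73 : Z ^ ((7 : ℝ) / 3) = Z ^ ((2 : ℝ) / 3) * Z ^ ((5 : ℝ) / 3) := by
    rw [← Real.rpow_add hZ0]; norm_num
  have h53 : Z ^ ((5 : ℝ) / 3) = Z ^ ((2 : ℝ) / 3) * Z := by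
    rw [← Real.rpow_add_one hZ0.ne']; norm_num
  calc Γ.exchange
      ≤ katoConst.toReal * (2 / Z ^ ((2 : ℝ) / 3) * Γ.trKinetic (Z / κ)
          + Z ^ ((2 : ℝ) / 3) / 2 * N) := OrbitalData.exchange_le hlam hs hsc
    _ ≤ katoConst.toReal * (2 / Z ^ ((2 : ℝ) / 3) * (B * Z ^ ((7 : ℝ) / 3))
          + Z ^ ((2 : ℝ) / 3) / 2 * (A * Z)) := by gcongr
    _ = katoConst.toReal * (2 * B + A / 2) * Z ^ ((5 : ℝ) / 3) := by
      rw [h73, h53]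
      field_simp
    _ ≤ _ := by
      gcongr
      linarith
end
end
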